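/- Let G be a (theta, prism)-free graph and let W = (H, c) be a special wheel in G whose long sectors have length at least three. Let a'' and b'' be vertices of G \ N[Z(W)] that belong to the interiors of distinct sectors of W. Then N[Z(W)] separates a'' and b'' in G. -/

import Mathlib

open SimpleGraph

namespace Paper

variable {V : Type}

/-- Two vertex sets are anticomplete: no edges between them. -/
def Anticomplete (G : SimpleGraph V) (A B : Set V) : Prop :=
  ∀ a ∈ A, ∀ b ∈ B, ¬ G.Adj a b

/-- A stable (independent) set of vertices. -/
def StableSet (G : SimpleGraph V) (A : Set V) : Prop :=
  ∀ x ∈ A, ∀ y ∈ A, x ≠ y → ¬ G.Adj x y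

/-- A walk is induced in `G`: any two adjacent vertices on it are consecutive. -/
def InducedWalk (G : SimpleGraph V) {u v : V} (P : G.Walk u v) : Prop :=
  ∀ x ∈ P.support, ∀ y ∈ P.support, G.Adj x y → s(x, y) ∈ P.edges

/-- The interior (set of internal vertices) of a walk from `u` to `v`. -/
def Interior {G : SimpleGraph V} {u v : V} (P : G.Walk u v) : Set V :=
  {w | w ∈ P.support ∧ w ≠ u ∧ w ≠ v}

/-- Closed neighborhood of a set of vertices. -/
def ClosedNbhd (G : SimpleGraph V) (A : Set V) : Set V :=
  A ∪ {v | ∃ a ∈ A, G.Adj v a}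

/-- Open neighborhood of a set of vertices. -/
def OpenNbhd (G : SimpleGraph V) (A : Set V) : Set V :=
  {v | v ∉ A ∧ ∃ a ∈ A, G.Adj v a}

/-- `M` separates `x` and `y` in `G`: there is a separation `(L, M, R)` with `x ∈ L`, `y ∈ R`. -/
def Separates (G : SimpleGraph V) (M : Set V) (x y : V) : Prop :=
  ∃ L R : Set V,
    L ∪ M ∪ R = Set.univ ∧
    Disjoint L M ∧ Disjoint L R ∧ Disjoint M R ∧
    L.Nonempty ∧ R.Nonempty ∧ Anticomplete G L R ∧ x ∈ L ∧ y ∈ R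

/-- `G` contains a theta as an induced subgraph. -/
def ContainsTheta (G : SimpleGraph V) : Prop :=
  ∃ (a b : V) (P₁ P₂ P₃ : G.Walk a b),
    a ≠ b ∧ ¬ G.Adj a b ∧
    P₁.IsPath ∧ P₂.IsPath ∧ P₃.IsPath ∧
    InducedWalk G P₁ ∧ InducedWalk G P₂ ∧ InducedWalk G P₃ ∧
    2 ≤ P₁.length ∧ 2 ≤ P₂.length ∧ 2 ≤ P₃.length ∧
    Disjoint (Interior P₁) (Interior P₂) ∧
    Disjoint (Interior P₁) (Interior P₃) ∧
    Disjoint (Interior P₂) (Interior P₃) ∧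
    Anticomplete G (Interior P₁) (Interior P₂) ∧
    Anticomplete G (Interior P₁) (Interior P₃) ∧
    Anticomplete G (Interior P₂) (Interior P₃)

/-- `G` contains a prism as an induced subgraph (one path may have length zero). -/
def ContainsPrism (G : SimpleGraph V) : Prop :=
  ∃ (a b : Fin 3 → V) (P : ∀ i, G.Walk (a i) (b i)),
    (∀ i j, i ≠ j → G.Adj (a i) (a j)) ∧
    (∀ i j, i ≠ j → G.Adj (b i) (b j)) ∧
    (∀ i, (P i).IsPath) ∧ (∀ i, InducedWalk G (P i)) ∧
    (∀ i j, i ≠ j → ∀ x, x ∈ (P i).support → x ∉ (P j).support) ∧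
    (∀ i j, i ≠ j → ∀ x ∈ (P i).support, ∀ y ∈ (P j).support,
        G.Adj x y → (x = a i ∧ y = a j) ∨ (x = b i ∧ y = b j)) ∧
    (∀ i j, i ≠ j → 2 ≤ (P i).length + (P j).length)

/-- `G` contains `K_{1,t}` as an induced subgraph. -/
def ContainsK1t (G : SimpleGraph V) (t : ℕ) : Prop :=
  ∃ (v : V) (S : Finset V),
    S.card = t ∧ v ∉ S ∧ (∀ x ∈ S, G.Adj v x) ∧ StableSet G ↑S

/-- `G` belongs to the class `C_t` of (theta, prism, `K_{1,t}`)-free graphs. -/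
def MemCt (t : ℕ) (G : SimpleGraph V) : Prop :=
  ¬ ContainsTheta G ∧ ¬ ContainsPrism G ∧ ¬ ContainsK1t G t

/-- A tree decomposition of `G`. -/
structure TreeDecomp (G : SimpleGraph V) where
  ι : Type
  T : SimpleGraph ι
  isTree : T.IsTree
  bag : ι → Set V
  mem_bag : ∀ v : V, ∃ i, v ∈ bag i
  edge_bag : ∀ u v : V, G.Adj u v → ∃ i, u ∈ bag i ∧ v ∈ bag i
  bag_connected : ∀ v : V, (T.induce {i | v ∈ bag i}).Connected

/-- The tree independence number of `G` is at most `k`. -/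
def TreeAlphaLE (G : SimpleGraph V) (k : ℕ) : Prop :=
  ∃ D : TreeDecomp G, ∀ i : D.ι, ∀ S : Finset V,
    ↑S ⊆ D.bag i → StableSet G ↑S → S.card ≤ k

/-- Sum of weights over a vertex set. -/
noncomputable def wSum [Fintype V] (w : V → ℝ) (A : Set V) : ℝ :=
  ∑ v, A.indicator w v

/-- `D` is a connected component of `G \ X`. -/
def IsComponentOf (G : SimpleGraph V) (X D : Set V) : Prop :=
  D.Nonempty ∧ D ⊆ Xᶜ ∧ (G.induce D).Connected ∧
  ∀ D' : Set V, D ⊆ D' → D' ⊆ Xᶜ → (G.induce D').Connected → D' = D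

/-- `X` is a `w`-balanced separator in `G`. -/
def BalancedSeparator [Fintype V] (G : SimpleGraph V) (w : V → ℝ) (X : Set V) : Prop :=
  ∀ D : Set V, IsComponentOf G X D → wSum w D ≤ 1 / 2

/-- A closed walk is a hole (induced cycle of length at least four) in `G`. -/
def IsHoleWalk (G : SimpleGraph V) {h : V} (H : G.Walk h h) : Prop :=
  H.IsCycle ∧ 4 ≤ H.length ∧ InducedWalk G H

/-- The neighbors of `c` on the hole `H`. -/
def HoleNbrs (G : SimpleGraph V) {h : V} (H : G.Walk h h) (c : V) : Set V :=
  {v | v ∈ H.support ∧ G.Adj c v}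

/-- `(H, c)` is a wheel in `G`. -/
def IsWheel (G : SimpleGraph V) {h : V} (H : G.Walk h h) (c : V) : Prop :=
  IsHoleWalk G H ∧ c ∉ H.support ∧ 3 ≤ (HoleNbrs G H c).ncard

/-- `P` is a sector of the wheel `(H, c)`. -/
def IsSector (G : SimpleGraph V) {h : V} (H : G.Walk h h) (c : V)
    {x y : V} (P : G.Walk x y) : Prop :=
  P.IsPath ∧ 0 < P.length ∧
  (∀ w ∈ P.support, w ∈ H.support) ∧
  (∀ e ∈ P.edges, e ∈ H.edges) ∧
  G.Adj c x ∧ G.Adj c y ∧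
  ∀ w ∈ P.support, w ≠ x → w ≠ y → ¬ G.Adj c w

/-- The wheel `(H, c)` is special. -/
def IsSpecialWheel (G : SimpleGraph V) {h : V} (H : G.Walk h h) (c : V) : Prop :=
  IsWheel G H c ∧ ∃ a b d : V,
    a ≠ b ∧ a ≠ d ∧ b ≠ d ∧
    HoleNbrs G H c = {a, b, d} ∧
    s(a, b) ∈ H.edges ∧ s(a, d) ∉ H.edges ∧ s(b, d) ∉ H.edges

/-- `Z(W)` for a non-special wheel `W = (H, c)`. -/
def ZNonSpecial (G : SimpleGraph V) {h : V} (H : G.Walk h h) (c : V) : Set V :=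
  {c} ∪ HoleNbrs G H c

/-- `Z(W)` for a special wheel `W = (H, c)` with length-one sector `ab` and third neighbor `d`. -/
def ZSpecial (G : SimpleGraph V) {h : V} (H : G.Walk h h) (c a b d : V) : Set V :=
  ({a, b, c, d} : Set V) ∪ {v | s(v, d) ∈ H.edges}

/-- A pyramid in `G` with apex `apx`, base `b 0, b 1, b 2` and paths `P i`. -/
def IsPyramid (G : SimpleGraph V) (apx : V) (b : Fin 3 → V)
    (P : ∀ i, G.Walk apx (b i)) : Prop :=
  (∀ i, b i ≠ apx) ∧
  (∀ i j, i ≠ j → G.Adj (b i) (b j)) ∧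
  (∀ i, (P i).IsPath) ∧ (∀ i, InducedWalk G (P i)) ∧
  (∀ i, 1 ≤ (P i).length) ∧
  (∀ i j, i ≠ j → ∀ x, x ∈ (P i).support → x ∈ (P j).support → x = apx) ∧
  (∀ i j, i ≠ j → ∀ x ∈ (P i).support, ∀ y ∈ (P j).support,
      x ≠ apx → y ≠ apx → G.Adj x y → x = b i ∧ y = b j) ∧
  (∀ i j, i ≠ j → 3 ≤ (P i).length + (P j).length)

/-- `Z(Σ)` for a pyramid. -/
def ZPyramid (G : SimpleGraph V) (apx : V) (b : Fin 3 → V)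
    (P : ∀ i, G.Walk apx (b i)) : Set V :=
  {apx} ∪ {v | (∃ i, v ∈ (P i).support) ∧ G.Adj apx v} ∪ Set.range b

/-- `x : Fin k → V` enumerates `X` in an order witnessing that `(P, X)` is an alignment. -/
def AlignmentOrder (G : SimpleGraph V) {p q : V} (P : G.Walk p q)
    (X : Finset V) {k : ℕ} (x : Fin k → V) : Prop :=
  Function.Injective x ∧ (∀ l, x l ∈ X) ∧ (∀ z ∈ X, ∃ l, x l = z) ∧
  ∃ lo hi : Fin k → ℕ,
    (∀ l, lo l ≤ hi l) ∧
    (∀ l m : Fin k, l < m → hi l < lo m) ∧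
    (∀ l, hi l < P.support.length) ∧
    ∀ (l : Fin k) (n : Fin P.support.length),
      G.Adj (x l) (P.support.get n) → lo l ≤ (n : ℕ) ∧ (n : ℕ) ≤ hi l

/-- `(P, X)` is an alignment. -/
def IsAlignment (G : SimpleGraph V) {p q : V} (P : G.Walk p q) (X : Finset V) : Prop :=
  (∀ z ∈ X, z ∉ P.support) ∧
  (∀ z ∈ X, ∃ u ∈ P.support, G.Adj z u) ∧
  ∃ (k : ℕ) (x : Fin k → V), AlignmentOrder G P X x

/-- Every vertex of `X` has two non-adjacent neighbors in `P`. -/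
def WideAl (G : SimpleGraph V) {p q : V} (P : G.Walk p q) (X : Finset V) : Prop :=
  ∀ z ∈ X, ∃ u v : V, u ∈ P.support ∧ v ∈ P.support ∧
    G.Adj z u ∧ G.Adj z v ∧ u ≠ v ∧ ¬ G.Adj u v

/-- Every vertex of `X` has a unique neighbor in `P`. -/
def SpikyAl (G : SimpleGraph V) {p q : V} (P : G.Walk p q) (X : Finset V) : Prop :=
  ∀ z ∈ X, ∃! u : V, u ∈ P.support ∧ G.Adj z u

/-- Every vertex of `X` has exactly two neighbors in `P`, and they are adjacent. -/
def TriangularAl (G : SimpleGraph V) {p q : V} (P : G.Walk p q) (X : Finset V) : Prop :=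
  ∀ z ∈ X, ∃ u v : V, u ∈ P.support ∧ v ∈ P.support ∧
    G.Adj z u ∧ G.Adj z v ∧ u ≠ v ∧ G.Adj u v ∧
    ∀ w ∈ P.support, G.Adj z w → w = u ∨ w = v

/-- `(P, X)` is a consistent alignment. -/
def ConsistentAlignment (G : SimpleGraph V) {p q : V} (P : G.Walk p q) (X : Finset V) : Prop :=
  IsAlignment G P X ∧ (WideAl G P X ∨ SpikyAl G P X ∨ TriangularAl G P X)

/-- A branch vertex of a graph: a vertex of degree at least three. -/
def BranchVtx {W : Type} (T : SimpleGraph W) (v : W) : Prop :=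
  3 ≤ (T.neighborSet v).ncard

/-- `T` is a caterpillar: a tree of maximum degree three, no two branch vertices adjacent,
and some path contains all branch vertices. -/
def IsCaterpillar {W : Type} (T : SimpleGraph W) : Prop :=
  T.IsTree ∧ (∀ v, (T.neighborSet v).ncard ≤ 3) ∧
  (∀ u v, BranchVtx T u → BranchVtx T v → ¬ T.Adj u v) ∧
  ∃ (x y : W) (P : T.Walk x y), P.IsPath ∧ ∀ v, BranchVtx T v → v ∈ P.support

/-- `T` is a subdivided star with root `r`. -/
def IsSubdividedStar {W : Type} (T : SimpleGraph W) (r : W) : Prop :=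
  T.IsTree ∧ 3 ≤ (T.neighborSet r).ncard ∧ ∀ v, v ≠ r → (T.neighborSet v).ncard ≤ 2

/-- `H` is isomorphic to the line graph of a caterpillar. -/
def IsLineCaterpillar {U : Type} (H : SimpleGraph U) : Prop :=
  ∃ (W : Type) (T : SimpleGraph W), IsCaterpillar T ∧ Nonempty (H ≃g T.lineGraph)

/-- `H` is isomorphic to the line graph of a subdivided star. -/
def IsLineSubdividedStar {U : Type} (H : SimpleGraph U) : Prop :=
  ∃ (W : Type) (T : SimpleGraph W) (r : W),
    IsSubdividedStar T r ∧ Nonempty (H ≃g T.lineGraph)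

/-- `v` is a simplicial vertex of `G[S]`. -/
def SimplicialIn (G : SimpleGraph V) (S : Set V) (v : V) : Prop :=
  v ∈ S ∧ ∀ u ∈ S, ∀ w ∈ S, G.Adj v u → G.Adj v w → u ≠ w → G.Adj u w

/-- `G[S]` is one of the four connectifier shapes. -/
def ConnType (G : SimpleGraph V) (S : Set V) : Prop :=
  IsCaterpillar (G.induce S) ∨ IsLineCaterpillar (G.induce S) ∨
  (∃ r, IsSubdividedStar (G.induce S) r) ∨ IsLineSubdividedStar (G.induce S)

/-- `(G[S], X)` is a connectifier. -/
def IsConnectifier (G : SimpleGraph V) (S : Set V) (X : Finset V) : Prop :=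
  (∀ z ∈ X, (z : V) ∉ S) ∧ (∀ z ∈ X, ∃ r ∈ S, G.Adj z r) ∧
  ( (∃ v, S = {v}) ∨
    ( ConnType G S ∧
      (∀ z ∈ X, ∀ r₁ ∈ S, ∀ r₂ ∈ S, G.Adj z r₁ → G.Adj z r₂ → r₁ = r₂) ∧
      (∀ z ∈ X, ∀ r ∈ S, G.Adj z r → SimplicialIn G S r) ∧
      (∀ v, SimplicialIn G S v → ∃ z ∈ X, G.Adj z v) ) )

/-- The connectifier `(G[S], X)` is concentrated. -/
def Concentrated (G : SimpleGraph V) (S : Set V) : Prop :=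
  (∃ v, S = {v}) ∨ (∃ r, IsSubdividedStar (G.induce S) r) ∨
  IsLineSubdividedStar (G.induce S)

/-- Reachability inside a vertex set `A`. -/
def Reaches (G : SimpleGraph V) (A : Set V) (u v : V) : Prop :=
  ∃ (w : G.Walk u v), ∀ z ∈ w.support, z ∈ A

/-- `Pw` is a spine of the caterpillar `G[S]`: a maximal path containing all branch vertices. -/
def IsSpineOf (G : SimpleGraph V) (S : Set V) {p q : V} (Pw : G.Walk p q) : Prop :=
  Pw.IsPath ∧ (∀ w ∈ Pw.support, w ∈ S) ∧
  (∀ v ∈ S, 3 ≤ ({u | u ∈ S ∧ G.Adj v u}).ncard → v ∈ Pw.support) ∧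
  ∀ (p' q' : V) (P' : G.Walk p' q'), P'.IsPath → (∀ w ∈ P'.support, w ∈ S) →
    (∀ w ∈ Pw.support, w ∈ P'.support) → ∀ w ∈ P'.support, w ∈ Pw.support

/-- `Pw` realizes `P(H)` for `H = G[S]`, when `H` is a caterpillar or the line graph
of a caterpillar. -/
def IsPHOf (G : SimpleGraph V) (S : Set V) {p q : V} (Pw : G.Walk p q) : Prop :=
  Pw.IsPath ∧ (∀ w ∈ Pw.support, w ∈ S) ∧
  ( (IsCaterpillar (G.induce S) ∧ IsSpineOf G S Pw) ∨
    (∃ (W : Type) (T : SimpleGraph W) (φ : T.lineGraph ≃g G.induce S)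
        (x y : W) (Q : T.Walk x y),
      IsCaterpillar T ∧ Q.IsPath ∧
      (∀ v, BranchVtx T v → v ∈ Q.support) ∧
      (∀ (x' y' : W) (Q' : T.Walk x' y'), Q'.IsPath →
        (∀ w ∈ Q.support, w ∈ Q'.support) → ∀ w ∈ Q'.support, w ∈ Q.support) ∧
      {w | w ∈ Pw.support} = {v : V | ∃ e : T.edgeSet, (e : Sym2 W) ∈ Q.edges ∧ ↑(φ e) = v}) )

/-- `x` enumerates `X` in the order given by the (non-concentrated) connectifier `(G[S], X)`
with central path `Pw = P(H)`. -/
def ConnectifierOrder (G : SimpleGraph V) (S : Set V) (X : Finset V)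
    {p q : V} (Pw : G.Walk p q) {k : ℕ} (x : Fin k → V) : Prop :=
  Function.Injective x ∧ (∀ l, x l ∈ X) ∧ (∀ z ∈ X, ∃ l, x l = z) ∧
  ∃ (s : Fin k → V) (lo hi : Fin k → ℕ),
    (∀ l, lo l ≤ hi l) ∧ (∀ l m : Fin k, l < m → hi l < lo m) ∧
    (∀ l, hi l < Pw.support.length) ∧
    (∀ (l : Fin k) (n : Fin Pw.support.length),
      G.Adj (s l) (Pw.support.get n) → lo l ≤ (n : ℕ) ∧ (n : ℕ) ≤ hi l) ∧
    ∀ l : Fin k, s l ∈ S ∧ s l ∉ Pw.support ∧ (∃ u ∈ Pw.support, G.Adj (s l) u) ∧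
      ∀ r ∈ S, G.Adj (x l) r → Reaches G (S \ {w | w ∈ Pw.support}) r (s l)

/-- `(G[S], X)` is a consistent alignment (with `G[S]` a path). -/
def ConsistentAlignmentSet (G : SimpleGraph V) (S : Set V) (X : Finset V) : Prop :=
  ∃ (p q : V) (Pw : G.Walk p q), Pw.IsPath ∧ InducedWalk G Pw ∧
    {w | w ∈ Pw.support} = S ∧ ConsistentAlignment G Pw X

/-- The orders on `X` given by `(D1, X)` and by `(G[S], X)` coincide. -/
def OrdersAgree (G : SimpleGraph V) {p q : V} (D1w : G.Walk p q)
    (S : Set V) (X : Finset V) : Prop :=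
  ∃ (k : ℕ) (x : Fin k → V),
    AlignmentOrder G D1w X x ∧
    ( (∃ (p' q' : V) (Pw : G.Walk p' q'), IsPHOf G S Pw ∧ ConnectifierOrder G S X Pw x) ∨
      (∃ (p' q' : V) (Pw : G.Walk p' q'), Pw.IsPath ∧ InducedWalk G Pw ∧
        {w | w ∈ Pw.support} = S ∧ AlignmentOrder G Pw X x) )

/-- `(D1, Y, D2)` is an `s`-trisection of `G`, where `D1` is (the support of) the path `D1w`. -/
def IsTrisection (G : SimpleGraph V) (s : ℕ) {p q : V} (D1w : G.Walk p q)
    (Y D2 : Set V) : Prop :=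
  D1w.IsPath ∧ InducedWalk G D1w ∧
  (∀ w ∈ D1w.support, w ∉ Y ∧ w ∉ D2) ∧ Disjoint Y D2 ∧
  ({w | w ∈ D1w.support} ∪ Y ∪ D2 = Set.univ) ∧
  D2.Nonempty ∧
  (∀ a ∈ D1w.support, ∀ b ∈ D2, ¬ G.Adj a b) ∧
  StableSet G Y ∧ Y.ncard = s ∧
  OpenNbhd G {w | w ∈ D1w.support} = Y ∧ OpenNbhd G D2 = Y ∧
  (∀ y ∈ Y, ∃ d ∈ D1w.support, ∀ z ∈ Y, (G.Adj d z ↔ z = y))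

/-- The conclusion of amiability for the trisection `(D1w, Y, D2)` with parameter `x`:
the pair `(G[S], X)` is "given by amiability". -/
def AmiableOutcome (G : SimpleGraph V) {p q : V} (D1w : G.Walk p q)
    (Y D2 : Set V) (x : ℕ) (S : Set V) (X : Finset V) : Prop :=
  S ⊆ D2 ∧ ↑X ⊆ Y ∧ X.card = x ∧
  ConsistentAlignment G D1w X ∧
  (IsConnectifier G S X ∨ ConsistentAlignmentSet G S X) ∧
  (¬ (IsConnectifier G S X ∧ Concentrated G S) → OrdersAgree G D1w S X)


theorem Reaches.refl {G : SimpleGraph V} {A : Set V} {u : V} (hu : u ∈ A) : Reaches G A u u :=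
  ⟨.nil, by simpa using hu⟩

theorem Reaches.mono {G : SimpleGraph V} {A B : Set V} {u v : V} (hAB : A ⊆ B)
    (h : Reaches G A u v) : Reaches G B u v :=
  h.imp fun _ hw z hz => hAB (hw z hz)

theorem Reaches.symm {G : SimpleGraph V} {A : Set V} {u v : V} (h : Reaches G A u v) :
    Reaches G A v u := by
  obtain ⟨w, hw⟩ := h
  exact ⟨w.reverse, by simpa using hw⟩

theorem Reaches.trans {G : SimpleGraph V} {A : Set V} {u v x : V} (h : Reaches G A u v)
    (h' : Reaches G A v x) : Reaches G A u x := by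
  obtain ⟨w, hw⟩ := h
  obtain ⟨w', hw'⟩ := h'
  refine ⟨w.append w', fun z hz => ?_⟩
  rcases (SimpleGraph.Walk.mem_support_append_iff _ _).1 hz with h | h
  exacts [hw z h, hw' z h]

theorem Reaches.of_adj {G : SimpleGraph V} {A : Set V} {u v : V} (hu : u ∈ A) (hv : v ∈ A)
    (h : G.Adj u v) : Reaches G A u v :=
  ⟨h.toWalk, by simp [hu, hv]⟩

theorem Reaches.of_seq {G : SimpleGraph V} {A : Set V} {p : ℕ → V} {i j : ℕ} (hij : i ≤ j)
    (hadj : ∀ k, i ≤ k → k < j → G.Adj (p k) (p (k + 1)))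
    (hA : ∀ k, i ≤ k → k ≤ j → p k ∈ A) : Reaches G A (p i) (p j) := by
  induction j, hij using Nat.le_induction with
  | base => exact .refl (hA i le_rfl le_rfl)
  | succ j hij ih =>
    exact (ih (fun k h h' => hadj k h (by omega)) (fun k h h' => hA k h (by omega))).trans
      (.of_adj (hA _ hij (by omega)) (hA _ (by omega) le_rfl) (hadj j hij (by omega)))

/-- A shortest walk inside a vertex set is an induced path. -/
theorem Reaches.exists_induced {G : SimpleGraph V} {A : Set V} {u v : V} (h : Reaches G A u v) :
    ∃ P : G.Walk u v, P.IsPath ∧ InducedWalk G P ∧ ∀ z ∈ P.support, z ∈ A := by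
  classical
  have hex : ∃ n, ∃ P : G.Walk u v, P.length = n ∧ ∀ z ∈ P.support, z ∈ A := by
    obtain ⟨w, hw⟩ := h
    exact ⟨_, w, rfl, hw⟩
  obtain ⟨P₀, hP₀, hA₀⟩ := Nat.find_spec hex
  have hmin : ∀ Q : G.Walk u v, (∀ z ∈ Q.support, z ∈ A) → P₀.bypass.length ≤ Q.length :=
    fun Q hQ => P₀.length_bypass_le_length.trans
      (hP₀.le.trans (Nat.find_min' hex ⟨Q, rfl, hQ⟩))
  have hA : ∀ z ∈ P₀.bypass.support, z ∈ A := fun z hz =>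
    hA₀ z (P₀.support_bypass_subset_support hz)
  refine ⟨P₀.bypass, P₀.bypass_isPath, ?_, hA⟩
  generalize P₀.bypass = P at hmin hA
  have key : ∀ i j, i ≤ j → j ≤ P.length → G.Adj (P.getVert i) (P.getVert j) →
      s(P.getVert i, P.getVert j) ∈ P.edges := by
    intro i j hij hj hadj
    have hlen := hmin ((P.take i).append (.cons hadj (P.drop j))) (fun z hz => by
      rw [Walk.mem_support_append_iff, Walk.support_cons, List.mem_cons] at hz
      rcases hz with hz | rfl | hz
      · exact hA z ((P.isSubwalk_take i).support_subset hz)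
      · exact hA _ (P.getVert_mem_support i)
      · exact hA z ((P.isSubwalk_drop j).support_subset hz))
    simp only [Walk.length_append, Walk.length_cons, Walk.take_length, Walk.drop_length] at hlen
    have hne : i ≠ j := by rintro rfl; exact hadj.ne rfl
    obtain rfl : j = i + 1 := by omega
    exact (P.mk_mem_edges_iff_exists).2 ⟨i, by omega, rfl⟩
  intro x hx y hy hxy
  obtain ⟨i, rfl, hi⟩ := Walk.mem_support_iff_exists_getVert.1 hx
  obtain ⟨j, rfl, hj⟩ := Walk.mem_support_iff_exists_getVert.1 hy
  rcases le_total i j with hij | hij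
  · exact key i j hij hj hxy
  · rw [Sym2.eq_swap]
    exact key j i hij hi hxy.symm

theorem two_le_length_of_not_adj {G : SimpleGraph V} {u v : V} (huv : u ≠ v)
    (hadj : ¬ G.Adj u v) (P : G.Walk u v) : 2 ≤ P.length := by
  by_contra! hlt
  interval_cases h : P.length
  · exact huv (Walk.eq_of_length_eq_zero h)
  · exact hadj (Walk.adj_of_length_eq_one h)

theorem containsTheta_of_reaches {G : SimpleGraph V} {a b : V} {A₁ A₂ A₃ : Set V}
    (hab : a ≠ b) (hadj : ¬ G.Adj a b)
    (h₁ : Reaches G (A₁ ∪ {a, b}) a b) (h₂ : Reaches G (A₂ ∪ {a, b}) a b)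
    (h₃ : Reaches G (A₃ ∪ {a, b}) a b)
    (d₁₂ : Disjoint A₁ A₂) (d₁₃ : Disjoint A₁ A₃) (d₂₃ : Disjoint A₂ A₃)
    (c₁₂ : Anticomplete G A₁ A₂) (c₁₃ : Anticomplete G A₁ A₃) (c₂₃ : Anticomplete G A₂ A₃) :
    ContainsTheta G := by
  obtain ⟨P₁, hp₁, hi₁, hs₁⟩ := h₁.exists_induced
  obtain ⟨P₂, hp₂, hi₂, hs₂⟩ := h₂.exists_induced
  obtain ⟨P₃, hp₃, hi₃, hs₃⟩ := h₃.exists_induced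
  have hmid : ∀ {A : Set V} {P : G.Walk a b}, (∀ z ∈ P.support, z ∈ A ∪ {a, b}) →
      Interior P ⊆ A := by
    rintro A P hs z ⟨hz, hza, hzb⟩
    rcases hs z hz with h | rfl | rfl
    exacts [h, (hza rfl).elim, (hzb rfl).elim]
  have s₁ := hmid hs₁
  have s₂ := hmid hs₂
  have s₃ := hmid hs₃
  exact ⟨a, b, P₁, P₂, P₃, hab, hadj, hp₁, hp₂, hp₃, hi₁, hi₂, hi₃,
    two_le_length_of_not_adj hab hadj _, two_le_length_of_not_adj hab hadj _,
    two_le_length_of_not_adj hab hadj _, d₁₂.mono s₁ s₂, d₁₃.mono s₁ s₃, d₂₃.mono s₂ s₃,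
    fun x hx y hy => c₁₂ x (s₁ hx) y (s₂ hy), fun x hx y hy => c₁₃ x (s₁ hx) y (s₃ hy),
    fun x hx y hy => c₂₃ x (s₂ hx) y (s₃ hy)⟩

theorem containsPrism_of_reaches {G : SimpleGraph V} {a b : Fin 3 → V} {A : Fin 3 → Set V}
    (ha : ∀ i j, i ≠ j → G.Adj (a i) (a j)) (hb : ∀ i j, i ≠ j → G.Adj (b i) (b j))
    (hA : ∀ i, Reaches G (A i) (a i) (b i))
    (hdisj : ∀ i j, i < j → Disjoint (A i) (A j))
    (hcross : ∀ i j, i < j → ∀ x ∈ A i, ∀ y ∈ A j, G.Adj x y →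
      (x = a i ∧ y = a j) ∨ (x = b i ∧ y = b j))
    (h₀ : a 0 ≠ b 0 ∧ ¬ G.Adj (a 0) (b 0)) (h₁ : a 1 ≠ b 1 ∧ ¬ G.Adj (a 1) (b 1)) :
    ContainsPrism G := by
  choose P hP hI hS using fun i => (hA i).exists_induced
  refine ⟨a, b, P, ha, hb, hP, hI, fun i j hij x hxi hxj => ?_,
    fun i j hij x hx y hy hxy => ?_, fun i j hij => ?_⟩
  · rcases lt_or_gt_of_ne hij with h | h
    · exact (Set.disjoint_left.1 (hdisj i j h)) (hS i x hxi) (hS j x hxj)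
    · exact (Set.disjoint_left.1 (hdisj j i h)) (hS j x hxj) (hS i x hxi)
  · rcases lt_or_gt_of_ne hij with h | h
    · exact hcross i j h x (hS i x hx) y (hS j y hy) hxy
    · rcases hcross j i h y (hS j y hy) x (hS i x hx) hxy.symm with h | h
      exacts [.inl h.symm, .inr h.symm]
  · have l₀ := two_le_length_of_not_adj h₀.1 h₀.2 (P 0)
    have l₁ := two_le_length_of_not_adj h₁.1 h₁.2 (P 1)
    fin_cases i <;> fin_cases j <;> simp at hij ⊢ <;> omega

/-- The vertex `c` is joined to the hole formed by the induced paths `p 0, …, p m` and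
`q 0, …, q n`, which share the end `d = p m = q n` and whose other ends are adjacent; the
neighbors of `c` on the hole are `p 0`, `q 0` and `d`. -/
structure SplitHole (G : SimpleGraph V) (c d : V) (p q : ℕ → V) (m n : ℕ) : Prop where
  two_le_left : 2 ≤ m
  two_le_right : 2 ≤ n
  left_end : p m = d
  right_end : q n = d
  left_inj : ∀ {i j}, i ≤ m → j ≤ m → p i = p j → i = j
  right_inj : ∀ {i j}, i ≤ n → j ≤ n → q i = q j → i = j
  left_adj : ∀ {i j}, i ≤ m → j ≤ m → (G.Adj (p i) (p j) ↔ i + 1 = j ∨ j + 1 = i)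
  right_adj : ∀ {i j}, i ≤ n → j ≤ n → (G.Adj (q i) (q j) ↔ i + 1 = j ∨ j + 1 = i)
  cross_ne : ∀ {i j}, i < m → j < n → p i ≠ q j
  cross_adj : ∀ {i j}, i < m → j < n → (G.Adj (p i) (q j) ↔ i = 0 ∧ j = 0)
  center_ne_left : ∀ {i}, i ≤ m → c ≠ p i
  center_ne_right : ∀ {i}, i ≤ n → c ≠ q i
  center_adj_left : ∀ {i}, i ≤ m → (G.Adj c (p i) ↔ i = 0 ∨ i = m)
  center_adj_right : ∀ {i}, i ≤ n → (G.Adj c (q i) ↔ i = 0 ∨ i = n)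

theorem SplitHole.symm {G : SimpleGraph V} {c d : V} {p q : ℕ → V} {m n : ℕ}
    (F : SplitHole G c d p q m n) : SplitHole G c d q p n m where
  two_le_left := F.two_le_right
  two_le_right := F.two_le_left
  left_end := F.right_end
  right_end := F.left_end
  left_inj := F.right_inj
  right_inj := F.left_inj
  left_adj := F.right_adj
  right_adj := F.left_adj
  cross_ne hi hj := (F.cross_ne hj hi).symm
  cross_adj hi hj := by rw [G.adj_comm, F.cross_adj hj hi, and_comm]
  center_ne_left := F.center_ne_right
  center_ne_right := F.center_ne_left
  center_adj_left := F.center_adj_right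
  center_adj_right := F.center_adj_left

/-- The vertex `z` lies off the center and its neighbors on the path `p 0, …, p m` avoid the
first vertex and the last two. -/
def FarFrom (G : SimpleGraph V) (c : V) (p : ℕ → V) (m : ℕ) (z : V) : Prop :=
  z ≠ c ∧ ¬ G.Adj z c ∧ ∀ i ≤ m, z ≠ p i ∧ (G.Adj z (p i) → 1 ≤ i ∧ i + 2 ≤ m)

theorem SplitHole.attaches_to_edge {G : SimpleGraph V} {c d : V} {p q : ℕ → V} {m n : ℕ}
    (F : SplitHole G c d p q m n) (hth : ¬ ContainsTheta G) {S : Set V} {x y : V}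
    (hS : Reaches G S x y) (hp : ∀ z ∈ S, FarFrom G c p m z) (hq : ∀ z ∈ S, FarFrom G c q n z)
    (hx : ∀ z ∈ S, ∀ k ≤ m, G.Adj z (p k) → z = x)
    (hpx : ∃ k ≤ m, G.Adj x (p k)) (hqy : ∃ k ≤ n, G.Adj y (q k)) :
    ∃ i, 1 ≤ i ∧ i + 3 ≤ m ∧ ∀ k ≤ m, G.Adj x (p k) ↔ k = i ∨ k = i + 1 := by
  classical
  have hxS : x ∈ S := by obtain ⟨w, hw⟩ := hS; exact hw x w.start_mem_support
  have hyS : y ∈ S := by obtain ⟨w, hw⟩ := hS; exact hw y w.end_mem_support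
  obtain ⟨hi, hxi⟩ := Nat.find_spec hpx
  have himin : ∀ k ≤ m, G.Adj x (p k) → Nat.find hpx ≤ k := fun k hk h =>
    Nat.find_min' hpx ⟨hk, h⟩
  generalize Nat.find hpx = i at hi hxi himin
  obtain ⟨j, ⟨hj, hxj⟩, hjmax⟩ : ∃ j, (j ≤ m ∧ G.Adj x (p j)) ∧
      ∀ k ≤ m, G.Adj x (p k) → k ≤ j :=
    ⟨Nat.findGreatest (fun k => k ≤ m ∧ G.Adj x (p k)) m,
      Nat.findGreatest_spec (P := fun k => k ≤ m ∧ G.Adj x (p k)) hi ⟨hi, hxi⟩,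
      fun k hk h => Nat.le_findGreatest hk ⟨hk, h⟩⟩
  have hij := himin j hj hxj
  obtain ⟨hi1, him⟩ := ((hp x hxS).2.2 i hi).2 hxi
  obtain ⟨hj1, hjm⟩ := ((hp x hxS).2.2 j hj).2 hxj
  obtain ⟨l, hl, hyl⟩ := hqy
  obtain ⟨hl1, hln⟩ := ((hq y hyS).2.2 l hl).2 hyl
  have hm := F.two_le_left
  have hn := F.two_le_right
  have hpd := F.left_end
  have hqd := F.right_end
  have hcd : G.Adj c d := hpd ▸ (F.center_adj_left le_rfl).2 (.inr rfl)
  have hc0 : G.Adj (p 0) c := ((F.center_adj_left (Nat.zero_le m)).2 (.inl rfl)).symm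
  have up : ∀ {A : Set V} {u v}, u ≤ v → v ≤ m → (∀ k, u ≤ k → k ≤ v → p k ∈ A) →
      Reaches G A (p u) (p v) := fun huv hv hA =>
    .of_seq huv (fun k _ _ => (F.left_adj (by omega) (by omega)).2 (.inl rfl)) hA
  have upq : ∀ {A : Set V} {u v}, u ≤ v → v ≤ n → (∀ k, u ≤ k → k ≤ v → q k ∈ A) →
      Reaches G A (q u) (q v) := fun huv hv hA =>
    .of_seq huv (fun k _ _ => (F.right_adj (by omega) (by omega)).2 (.inl rfl)) hA
  have hpS : ∀ z ∈ S, ∀ k ≤ m, z ≠ p k := fun z hz k hk => ((hp z hz).2.2 k hk).1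
  have hqS : ∀ z ∈ S, ∀ k ≤ n, z ≠ q k := fun z hz k hk => ((hq z hz).2.2 k hk).1
  -- the part of the hole between `d` and `q 0`, together with `S`, connects `x` to `d`
  have route : ∀ {A : Set V}, S ⊆ A → (∀ k, 1 ≤ k → k ≤ n → q k ∈ A) → Reaches G A x d := by
    intro A hSA hqA
    refine (hS.mono hSA).trans ((Reaches.of_adj (hSA hyS) (hqA l hl1 hl) hyl).trans ?_)
    rw [← hqd]
    exact upq hl le_rfl fun k hk hk' => hqA k (by omega) hk'
  -- the part of the hole between `p u` and `p 0`, together with `c`, connects `p u` to `d`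
  have detour : ∀ {A : Set V} {u}, u ≤ m → (∀ k ≤ u, p k ∈ A) → c ∈ A → d ∈ A →
      Reaches G A (p u) d := by
    intro A u hu hpA hcA hdA
    exact (up (Nat.zero_le u) hu fun k _ hk => hpA k hk).symm.trans
      ((Reaches.of_adj (hpA 0 (Nat.zero_le u)) hcA hc0).trans (.of_adj hcA hdA hcd))
  rcases Nat.lt_or_ge (i + 1) j with hlt | hge
  · exfalso
    refine hth (containsTheta_of_reaches (a := x) (b := d)
        (A₁ := {z | ∃ k, j ≤ k ∧ k < m ∧ z = p k})
      (A₂ := {z | (∃ k, k ≤ i ∧ z = p k) ∨ z = c})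
      (A₃ := {z | (z ∈ S ∧ z ≠ x) ∨ ∃ k, 1 ≤ k ∧ k < n ∧ z = q k})
      ?_ ?_ ?_ ?_ ?_ ?_ ?_ ?_ ?_ ?_ ?_)
    · rw [← hpd]; exact hpS x hxS m le_rfl
    · rw [← hpd]; intro h
      have := ((hp x hxS).2.2 m le_rfl).2 h
      omega
    · have hA : ∀ k, j ≤ k → k ≤ m →
          p k ∈ {z | ∃ k, j ≤ k ∧ k < m ∧ z = p k} ∪ ({x, d} : Set V) := by
        intro k hk hk'
        rcases hk'.lt_or_eq with h | rfl
        · exact .inl ⟨k, hk, h, rfl⟩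
        · exact .inr (.inr hpd)
      refine (Reaches.of_adj (.inr (.inl rfl)) (hA j le_rfl hj) hxj).trans ?_
      rw [← hpd] at hA ⊢
      exact up hj le_rfl hA
    · exact (Reaches.of_adj (.inr (.inl rfl)) (.inl (.inl ⟨i, le_rfl, rfl⟩)) hxi).trans
        (detour hi (fun k hk => .inl (.inl ⟨k, hk, rfl⟩)) (.inl (.inr rfl)) (.inr (.inr rfl)))
    · refine route (fun z hz => ?_) (fun k hk hk' => ?_)
      · by_cases h : z = x
        · exact .inr (.inl h)
        · exact .inl (.inl ⟨hz, h⟩)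
      · rcases hk'.lt_or_eq with h | rfl
        · exact .inl (.inr ⟨k, hk, h, rfl⟩)
        · exact .inr (.inr hqd)
    · rw [Set.disjoint_left]
      rintro _ ⟨k, hk, hk', rfl⟩ (⟨k', h, e⟩ | e)
      · have := F.left_inj (by omega) (by omega) e
        omega
      · exact F.center_ne_left hk'.le e.symm
    · rw [Set.disjoint_left]
      rintro _ ⟨k, hk, hk', rfl⟩ (⟨h, -⟩ | ⟨k', h, h', e⟩)
      · exact hpS _ h k hk'.le rfl
      · exact F.cross_ne hk' h' e
    · rw [Set.disjoint_left]
      rintro _ (⟨k, hk, rfl⟩ | rfl) (⟨h, -⟩ | ⟨k', h, h', e⟩)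
      · exact hpS _ h k (by omega) rfl
      · exact F.cross_ne (by omega) h' e
      · exact (hp _ h).1 rfl
      · exact F.center_ne_right h'.le e
    · rintro _ ⟨k, hk, hk', rfl⟩ _ (⟨k', h, rfl⟩ | rfl) e
      · have := (F.left_adj (by omega) (by omega)).1 e
        omega
      · have := (F.center_adj_left (by omega)).1 e.symm
        omega
    · rintro _ ⟨k, hk, hk', rfl⟩ _ (⟨h, h'⟩ | ⟨k', h, h', rfl⟩) e
      · exact h' (hx _ h k hk'.le e.symm)
      · have := (F.cross_adj hk' h').1 e
        omega
    · rintro _ (⟨k, hk, rfl⟩ | rfl) _ (⟨h, h'⟩ | ⟨k', h, h', rfl⟩) e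
      · exact h' (hx _ h k (by omega) e.symm)
      · have := (F.cross_adj (by omega) h').1 e
        omega
      · exact (hp _ h).2.1 e.symm
      · have := (F.center_adj_right h'.le).1 e
        omega
  rcases hij.eq_or_lt with rfl | hlt
  · exfalso
    have honly : ∀ z ∈ S, ∀ k ≤ m, G.Adj z (p k) → k = i := by
      intro z hz k hk h
      obtain rfl := hx z hz k hk h
      exact le_antisymm (hjmax k hk h) (himin k hk h)
    refine hth (containsTheta_of_reaches (a := p i) (b := d)
      (A₁ := {z | ∃ k, i < k ∧ k < m ∧ z = p k})
      (A₂ := {z | (∃ k, k < i ∧ z = p k) ∨ z = c})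
      (A₃ := {z | z ∈ S ∨ ∃ k, 1 ≤ k ∧ k < n ∧ z = q k})
      ?_ ?_ ?_ ?_ ?_ ?_ ?_ ?_ ?_ ?_ ?_)
    · rw [← hpd]; intro h
      have := F.left_inj hi le_rfl h
      omega
    · rw [← hpd]; intro h
      have := (F.left_adj hi le_rfl).1 h
      omega
    · have hA : ∀ k, i ≤ k → k ≤ m →
          p k ∈ {z | ∃ k, i < k ∧ k < m ∧ z = p k} ∪ ({p i, d} : Set V) := by
        intro k hk hk'
        rcases hk.eq_or_lt with rfl | hk
        · exact .inr (.inl rfl)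
        rcases hk'.lt_or_eq with h | rfl
        · exact .inl ⟨k, hk, h, rfl⟩
        · exact .inr (.inr hpd)
      rw [← hpd] at hA ⊢
      exact up hi le_rfl hA
    · refine detour hi (fun k hk => ?_) (.inl (.inr rfl)) (.inr (.inr rfl))
      rcases hk.lt_or_eq with h | rfl
      · exact .inl (.inl ⟨k, h, rfl⟩)
      · exact .inr (.inl rfl)
    · refine (Reaches.of_adj (.inr (.inl rfl)) (.inl (.inl hxS)) hxi.symm).trans
        (route (fun z hz => .inl (.inl hz)) (fun k hk hk' => ?_))
      rcases hk'.lt_or_eq with h | rfl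
      · exact .inl (.inr ⟨k, hk, h, rfl⟩)
      · exact .inr (.inr hqd)
    · rw [Set.disjoint_left]
      rintro _ ⟨k, hk, hk', rfl⟩ (⟨k', h, e⟩ | e)
      · have := F.left_inj (by omega) (by omega) e
        omega
      · exact F.center_ne_left hk'.le e.symm
    · rw [Set.disjoint_left]
      rintro _ ⟨k, hk, hk', rfl⟩ (h | ⟨k', h, h', e⟩)
      · exact hpS _ h k hk'.le rfl
      · exact F.cross_ne hk' h' e
    · rw [Set.disjoint_left]
      rintro _ (⟨k, hk, rfl⟩ | rfl) (h | ⟨k', h, h', e⟩)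
      · exact hpS _ h k (by omega) rfl
      · exact F.cross_ne (by omega) h' e
      · exact (hp _ h).1 rfl
      · exact F.center_ne_right h'.le e
    · rintro _ ⟨k, hk, hk', rfl⟩ _ (⟨k', h, rfl⟩ | rfl) e
      · have := (F.left_adj (by omega) (by omega)).1 e
        omega
      · have := (F.center_adj_left (by omega)).1 e.symm
        omega
    · rintro _ ⟨k, hk, hk', rfl⟩ _ (h | ⟨k', h, h', rfl⟩) e
      · exact hk.ne' (honly _ h k hk'.le e.symm)
      · have := (F.cross_adj hk' h').1 e
        omega
    · rintro _ (⟨k, hk, rfl⟩ | rfl) _ (h | ⟨k', h, h', rfl⟩) e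
      · exact hk.ne (honly _ h k (by omega) e.symm)
      · have := (F.cross_adj (by omega) h').1 e
        omega
      · exact (hp _ h).2.1 e.symm
      · have := (F.center_adj_right h'.le).1 e
        omega
  · obtain rfl : j = i + 1 := by omega
    refine ⟨i, hi1, hjm, fun k hk => ⟨fun h => ?_, ?_⟩⟩
    · have := himin k hk h
      have := hjmax k hk h
      omega
    · rintro (rfl | rfl)
      exacts [hxi, hxj]

/-- In a (theta, prism)-free graph, no connected set far from both paths attaches to both. -/
theorem SplitHole.not_reaches {G : SimpleGraph V} {c d : V} {p q : ℕ → V} {m n : ℕ}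
    (F : SplitHole G c d p q m n) (hth : ¬ ContainsTheta G) (hpr : ¬ ContainsPrism G)
    {S : Set V} {x y : V}
    (hS : Reaches G S x y) (hp : ∀ z ∈ S, FarFrom G c p m z) (hq : ∀ z ∈ S, FarFrom G c q n z)
    (hx : ∀ z ∈ S, ∀ k ≤ m, G.Adj z (p k) → z = x)
    (hy : ∀ z ∈ S, ∀ k ≤ n, G.Adj z (q k) → z = y)
    (hpx : ∃ k ≤ m, G.Adj x (p k)) (hqy : ∃ k ≤ n, G.Adj y (q k)) : False := by
  obtain ⟨i, hi1, him, hi⟩ := F.attaches_to_edge hth hS hp hq hx hpx hqy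
  obtain ⟨j, hj1, hjn, hj⟩ := F.symm.attaches_to_edge hth hS.symm hq hp hy hqy hpx
  have hpd := F.left_end
  have hqd := F.right_end
  have hxi : G.Adj x (p i) := (hi i (by omega)).2 (.inl rfl)
  have hxi' : G.Adj x (p (i + 1)) := (hi _ (by omega)).2 (.inr rfl)
  have hyj : G.Adj y (q j) := (hj j (by omega)).2 (.inl rfl)
  have hyj' : G.Adj y (q (j + 1)) := (hj _ (by omega)).2 (.inr rfl)
  have hpp : G.Adj (p i) (p (i + 1)) := (F.left_adj (by omega) (by omega)).2 (.inl rfl)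
  have hqq : G.Adj (q j) (q (j + 1)) := (F.right_adj (by omega) (by omega)).2 (.inl rfl)
  have hpS : ∀ z ∈ S, ∀ k ≤ m, z ≠ p k := fun z hz k hk => ((hp z hz).2.2 k hk).1
  have hqS : ∀ z ∈ S, ∀ k ≤ n, z ≠ q k := fun z hz k hk => ((hq z hz).2.2 k hk).1
  have hcol : ∀ {u v w : V}, G.Adj u v → G.Adj w u → G.Adj w v →
      ∀ s t : Fin 3, s ≠ t → G.Adj (![u, v, w] s) (![u, v, w] t) := by
    intro u v w h₁ h₂ h₃ s t hst
    fin_cases s <;> fin_cases t <;> simp_all [G.adj_comm]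
  have hne : ∀ k l, k ≤ i → j < l → l ≤ n → p k ≠ q l := by
    intro k l hk hl hl' e
    rcases hl'.lt_or_eq with h | rfl
    · exact F.cross_ne (by omega) h e
    · have := F.left_inj (by omega) le_rfl (e.trans (hqd.trans hpd.symm))
      omega
  have hne' : ∀ k l, i < k → k ≤ m → l ≤ j → p k ≠ q l := by
    intro k l hk hk' hl e
    rcases hk'.lt_or_eq with h | rfl
    · exact F.cross_ne h (by omega) e
    · have := F.right_inj (by omega) le_rfl (e.symm.trans (hpd.trans hqd.symm))
      omega
  have hnadj : ∀ k l, i < k → k ≤ m → l ≤ j → ¬ G.Adj (p k) (q l) := by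
    intro k l hk hk' hl e
    rcases hk'.lt_or_eq with h | rfl
    · have := (F.cross_adj h (by omega)).1 e
      omega
    · rw [hpd, ← hqd] at e
      have := (F.right_adj le_rfl (by omega)).1 e
      omega
  set A₀ : Set V := {z | (∃ k, k ≤ i ∧ z = p k) ∨ ∃ k, k ≤ j ∧ z = q k}
  set A₁ : Set V := {z | (∃ k, i < k ∧ k ≤ m ∧ z = p k) ∨ ∃ k, j < k ∧ k < n ∧ z = q k}
  have r₀ : Reaches G A₀ (p i) (q j) := by
    have hp' : Reaches G A₀ (p 0) (p i) := .of_seq (Nat.zero_le i)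
      (fun k _ _ => (F.left_adj (by omega) (by omega)).2 (.inl rfl))
      (fun k _ hk => .inl ⟨k, hk, rfl⟩)
    have hq' : Reaches G A₀ (q 0) (q j) := .of_seq (Nat.zero_le j)
      (fun k _ _ => (F.right_adj (by omega) (by omega)).2 (.inl rfl))
      (fun k _ hk => .inr ⟨k, hk, rfl⟩)
    exact hp'.symm.trans (.trans (.of_adj (.inl ⟨0, by omega, rfl⟩) (.inr ⟨0, by omega, rfl⟩)
      ((F.cross_adj (by omega) (by omega)).2 ⟨rfl, rfl⟩)) hq')
  have r₁ : Reaches G A₁ (p (i + 1)) (q (j + 1)) := by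
    have hp' : Reaches G A₁ (p (i + 1)) (p m) := .of_seq (by omega)
      (fun k _ _ => (F.left_adj (by omega) (by omega)).2 (.inl rfl))
      (fun k hk hk' => .inl ⟨k, by omega, hk', rfl⟩)
    have hq' : Reaches G A₁ (q (j + 1)) (q n) := .of_seq (by omega)
      (fun k _ _ => (F.right_adj (by omega) (by omega)).2 (.inl rfl))
      (fun k hk hk' => by
        rcases hk'.lt_or_eq with h | rfl
        · exact .inr ⟨k, by omega, h, rfl⟩
        · exact .inl ⟨m, by omega, le_rfl, hqd.trans hpd.symm⟩)
    rw [hqd, ← hpd] at hq'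
    exact hp'.trans hq'.symm
  have d₀₁ : Disjoint A₀ A₁ := by
    rw [Set.disjoint_left]
    rintro _ (⟨k, hk, rfl⟩ | ⟨k, hk, rfl⟩) (⟨l, hl, hl', e⟩ | ⟨l, hl, hl', e⟩)
    · have := F.left_inj (by omega) (by omega) e
      omega
    · exact hne _ _ hk hl hl'.le e
    · exact hne' _ _ hl hl' hk e.symm
    · have := F.right_inj (by omega) (by omega) e
      omega
  have d₀₂ : Disjoint A₀ S := by
    rw [Set.disjoint_left]
    rintro _ (⟨k, hk, rfl⟩ | ⟨k, hk, rfl⟩) h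
    exacts [hpS _ h k (by omega) rfl, hqS _ h k (by omega) rfl]
  have d₁₂ : Disjoint A₁ S := by
    rw [Set.disjoint_left]
    rintro _ (⟨k, hk, hk', rfl⟩ | ⟨k, hk, hk', rfl⟩) h
    exacts [hpS _ h k (by omega) rfl, hqS _ h k (by omega) rfl]
  have c₀₁ : ∀ z ∈ A₀, ∀ w ∈ A₁, G.Adj z w →
      (z = p i ∧ w = p (i + 1)) ∨ (z = q j ∧ w = q (j + 1)) := by
    rintro _ (⟨k, hk, rfl⟩ | ⟨k, hk, rfl⟩) _ (⟨l, hl, hl', rfl⟩ | ⟨l, hl, hl', rfl⟩) e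
    · have := (F.left_adj (by omega) (by omega)).1 e
      obtain rfl : k = i := by omega
      obtain rfl : l = k + 1 := by omega
      exact .inl ⟨rfl, rfl⟩
    · have := (F.cross_adj (by omega) hl').1 e
      omega
    · exact (hnadj _ _ hl hl' hk e.symm).elim
    · have := (F.right_adj (by omega) (by omega)).1 e
      obtain rfl : k = j := by omega
      obtain rfl : l = k + 1 := by omega
      exact .inr ⟨rfl, rfl⟩
  have c₀₂ : ∀ z ∈ A₀, ∀ w ∈ S, G.Adj z w → (z = p i ∧ w = x) ∨ (z = q j ∧ w = y) := by
    rintro _ (⟨k, hk, rfl⟩ | ⟨k, hk, rfl⟩) w hw e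
    · obtain rfl := hx w hw k (by omega) e.symm
      have := (hi k (by omega)).1 e.symm
      obtain rfl : k = i := by omega
      exact .inl ⟨rfl, rfl⟩
    · obtain rfl := hy w hw k (by omega) e.symm
      have := (hj k (by omega)).1 e.symm
      obtain rfl : k = j := by omega
      exact .inr ⟨rfl, rfl⟩
  have c₁₂ : ∀ z ∈ A₁, ∀ w ∈ S, G.Adj z w →
      (z = p (i + 1) ∧ w = x) ∨ (z = q (j + 1) ∧ w = y) := by
    rintro _ (⟨k, hk, hk', rfl⟩ | ⟨k, hk, hk', rfl⟩) w hw e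
    · obtain rfl := hx w hw k (by omega) e.symm
      have := (hi k (by omega)).1 e.symm
      obtain rfl : k = i + 1 := by omega
      exact .inl ⟨rfl, rfl⟩
    · obtain rfl := hy w hw k (by omega) e.symm
      have := (hj k (by omega)).1 e.symm
      obtain rfl : k = j + 1 := by omega
      exact .inr ⟨rfl, rfl⟩
  refine hpr (containsPrism_of_reaches (a := ![p i, p (i + 1), x]) (b := ![q j, q (j + 1), y])
    (A := ![A₀, A₁, S]) (hcol hpp hxi hxi') (hcol hqq hyj hyj') ?_ ?_ ?_ ?_ ?_)
  · intro s
    fin_cases s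
    exacts [r₀, r₁, hS]
  · intro s t hst
    fin_cases s <;> fin_cases t <;> first | exact absurd hst (by decide) | assumption
  · intro s t hst
    fin_cases s <;> fin_cases t <;> first | exact absurd hst (by decide) | assumption
  · refine ⟨F.cross_ne (by omega) (by omega), fun e => ?_⟩
    have := (F.cross_adj (by omega) (by omega)).1 e
    omega
  · refine ⟨F.cross_ne (by omega) (by omega), fun e => ?_⟩
    have := (F.cross_adj (by omega) (by omega)).1 e
    omega

/-- Every walk between the two paths of the hole meets a set `M` outside of which vertices are far
from the center and from the ends of the paths. -/
theorem SplitHole.not_reaches_compl {G : SimpleGraph V} {c d : V} {p q : ℕ → V} {m n : ℕ}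
    (F : SplitHole G c d p q m n) (hth : ¬ ContainsTheta G) (hpr : ¬ ContainsPrism G) {M : Set V}
    (hc : ∀ z ∉ M, z ≠ c ∧ ¬ G.Adj z c)
    (hp : ∀ z ∉ M, ∀ k ≤ m, (z = p k → 0 < k ∧ k < m) ∧ (G.Adj z (p k) → 1 ≤ k ∧ k + 2 ≤ m))
    (hq : ∀ z ∉ M, ∀ k ≤ n, (z = q k → 0 < k ∧ k < n) ∧ (G.Adj z (q k) → 1 ≤ k ∧ k + 2 ≤ n))
    {i j : ℕ} (hi : i ≤ m) (hj : j ≤ n) : ¬ Reaches G Mᶜ (p i) (q j) := by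
  classical
  rintro ⟨w, hw⟩
  have tp : ∀ z ∉ M, ∀ k ≤ m, z = p k → ∃ l ≤ m, G.Adj z (p l) := by
    rintro _ hz k hk rfl
    have := ((hp _ hz k hk).1 rfl).2
    exact ⟨k + 1, by omega, (F.left_adj hk (by omega)).2 (.inl rfl)⟩
  have tq : ∀ z ∉ M, ∀ k ≤ n, z = q k → ∃ l ≤ n, G.Adj z (q l) := by
    rintro _ hz k hk rfl
    have := ((hq _ hz k hk).1 rfl).2
    exact ⟨k + 1, by omega, (F.right_adj hk (by omega)).2 (.inl rfl)⟩
  have hex : ∃ N, ∃ (x y : V) (R : G.Walk x y), R.length = N ∧ (∀ z ∈ R.support, z ∉ M) ∧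
      (∃ k ≤ m, G.Adj x (p k)) ∧ ∃ k ≤ n, G.Adj y (q k) :=
    ⟨_, _, _, w, rfl, hw, tp _ (hw _ w.start_mem_support) i hi rfl,
      tq _ (hw _ w.end_mem_support) j hj rfl⟩
  obtain ⟨x, y, R, hlen, hRM, hx, hy⟩ := Nat.find_spec hex
  have hmin : ∀ {x' y' : V} (R' : G.Walk x' y'), (∀ z ∈ R'.support, z ∉ M) →
      (∃ k ≤ m, G.Adj x' (p k)) → (∃ k ≤ n, G.Adj y' (q k)) → R.length ≤ R'.length :=
    fun R' h h₁ h₂ => hlen.le.trans (Nat.find_min' hex ⟨_, _, R', rfl, h, h₁, h₂⟩)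
  have ux : ∀ z ∈ R.support, (∃ k ≤ m, G.Adj z (p k)) → z = x := by
    intro z hz h
    by_contra hne
    have h₁ := hmin (R.dropUntil z hz)
      (fun v hv => hRM v (R.support_dropUntil_subset_support hz hv)) h hy
    have h₂ := Walk.length_dropUntil_lt_length hz hne
    omega
  have uy : ∀ z ∈ R.support, (∃ k ≤ n, G.Adj z (q k)) → z = y := by
    intro z hz h
    by_contra hne
    have h₁ := hmin (R.takeUntil z hz)
      (fun v hv => hRM v (R.support_takeUntil_subset_support hz hv)) hx h
    have h₂ := Walk.length_takeUntil_lt_length hz hne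
    omega
  have hxM := hRM x R.start_mem_support
  have hyM := hRM y R.end_mem_support
  -- a vertex of the left path outside `M` has no neighbor on the right path
  have sp : ∀ {p q : ℕ → V} {m n : ℕ}, SplitHole G c d p q m n → ∀ z,
      (∀ k ≤ m, z = p k → 0 < k ∧ k < m) →
      (∀ k ≤ n, G.Adj z (q k) → 1 ≤ k ∧ k + 2 ≤ n) →
      ∀ k ≤ m, z = p k → ¬ ∃ l ≤ n, G.Adj z (q l) := by
    rintro p q m n F _ h₁ h₂ k hk rfl ⟨l, hl, e⟩
    have h₃ := h₁ k hk rfl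
    have h₄ := h₂ l hl e
    have := (F.cross_adj h₃.2 (by omega)).1 e
    omega
  have offp : ∀ z ∈ R.support, ∀ k ≤ m, z ≠ p k := by
    intro z hz k hk e
    obtain rfl := ux z hz (tp z (hRM z hz) k hk e)
    cases R with
    | nil => exact sp F _ (fun k hk => (hp _ hxM k hk).1) (fun k hk => (hq _ hxM k hk).2) k hk e hy
    | @cons _ v _ h R' =>
      have := ux v (by simp) ⟨k, hk, e ▸ h.symm⟩
      exact h.ne this.symm
  have offq : ∀ z ∈ R.support, ∀ k ≤ n, z ≠ q k := by
    intro z hz k hk e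
    obtain rfl := uy z hz (tq z (hRM z hz) k hk e)
    have hrev : ∀ v ∈ R.reverse.support, v ∈ R.support := by simp
    generalize R.reverse = R₁ at hrev
    cases R₁ with
    | nil =>
      exact sp F.symm _ (fun k hk => (hq _ hyM k hk).1) (fun k hk => (hp _ hyM k hk).2) k hk e hx
    | @cons _ v _ h R' =>
      have := uy v (hrev v (by simp)) ⟨k, hk, e ▸ h.symm⟩
      exact h.ne this.symm
  refine F.not_reaches hth hpr (S := {z | z ∈ R.support}) ⟨R, fun z hz => hz⟩
    (fun z hz => ⟨(hc z (hRM z hz)).1, (hc z (hRM z hz)).2,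
      fun k hk => ⟨offp z hz k hk, (hp z (hRM z hz) k hk).2⟩⟩)
    (fun z hz => ⟨(hc z (hRM z hz)).1, (hc z (hRM z hz)).2,
      fun k hk => ⟨offq z hz k hk, (hq z (hRM z hz) k hk).2⟩⟩)
    (fun z hz k hk h => ux z hz ⟨k, hk, h⟩) (fun z hz k hk h => uy z hz ⟨k, hk, h⟩) hx hy

theorem separates_of_not_reaches {G : SimpleGraph V} {M : Set V} {x y : V}
    (hx : x ∉ M) (hy : y ∉ M) (h : ¬ Reaches G Mᶜ x y) : Separates G M x y := by
  refine ⟨{v | Reaches G Mᶜ x v}, {v | v ∉ M ∧ ¬ Reaches G Mᶜ x v}, ?_, ?_, ?_, ?_,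
    ⟨x, .refl hx⟩, ⟨y, hy, h⟩, ?_, .refl hx, hy, h⟩
  · ext v
    simp only [Set.mem_union, Set.mem_ofPred_eq, Set.mem_univ, iff_true]
    tauto
  · rw [Set.disjoint_left]
    rintro v ⟨w, hw⟩
    exact hw v w.end_mem_support
  · rw [Set.disjoint_left]
    exact fun v hv hv' => hv'.2 hv
  · rw [Set.disjoint_left]
    exact fun v hv hv' => hv'.1 hv
  · rintro u hu v ⟨hv, hv'⟩ e
    obtain ⟨w, hw⟩ := hu
    exact hv' (Reaches.trans ⟨w, hw⟩ (.of_adj (hw u w.end_mem_support) hv e))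

theorem getVert_eq_of_isCycle {G : SimpleGraph V} {h : V} {H : G.Walk h h} (hH : H.IsCycle)
    {i j : ℕ} (hi : i ≤ H.length) (hj : j ≤ H.length) (e : H.getVert i = H.getVert j) :
    i = j ∨ (i = 0 ∧ j = H.length) ∨ (i = H.length ∧ j = 0) := by
  rcases Nat.eq_zero_or_pos i with hi0 | hi0
  · rcases hj.lt_or_eq with hj' | hj'
    · exact .inl (hH.getVert_injOn' (by simp; omega) (by simp; omega) e)
    · exact .inr (.inl ⟨hi0, hj'⟩)
  · rcases Nat.eq_zero_or_pos j with hj0 | hj0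
    · rcases hi.lt_or_eq with hi' | hi'
      · exact .inl (hH.getVert_injOn' (by simp; omega) (by simp; omega) e)
      · exact .inr (.inr ⟨hi', hj0⟩)
    · exact .inl (hH.getVert_injOn ⟨hi0, hi⟩ ⟨hj0, hj⟩ e)

theorem adj_getVert_of_isHoleWalk {G : SimpleGraph V} {h : V} {H : G.Walk h h}
    (hH : IsHoleWalk G H) {i j : ℕ} (hi : i ≤ H.length) (hj : j ≤ H.length) :
    G.Adj (H.getVert i) (H.getVert j) ↔ i + 1 = j ∨ j + 1 = i ∨ (i = 0 ∧ j + 1 = H.length) ∨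
      (j = 0 ∧ i + 1 = H.length) ∨ (i = H.length ∧ j = 1) ∨ (i = 1 ∧ j = H.length) := by
  obtain ⟨hcyc, hlen, hind⟩ := hH
  have hinj := fun {i j} => getVert_eq_of_isCycle hcyc (i := i) (j := j)
  have h0 : H.getVert 0 = H.getVert H.length := by simp
  constructor
  · intro e
    obtain ⟨k, hk, hk'⟩ := (H.mk_mem_edges_iff_exists).1
      (hind _ (H.getVert_mem_support i) _ (H.getVert_mem_support j) e)
    rcases Sym2.eq_iff.1 hk' with ⟨h₁, h₂⟩ | ⟨h₁, h₂⟩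
    · have := hinj (by omega) hi h₁
      have := hinj (by omega) hj h₂
      omega
    · have := hinj (by omega) hj h₁
      have := hinj (by omega) hi h₂
      omega
  · have hs : ∀ k, k < H.length → G.Adj (H.getVert k) (H.getVert (k + 1)) :=
      fun k hk => H.adj_getVert_succ hk
    rintro (rfl | rfl | ⟨rfl, h'⟩ | ⟨rfl, h'⟩ | ⟨rfl, rfl⟩ | ⟨rfl, rfl⟩)
    · exact hs _ (by omega)
    · exact (hs _ (by omega)).symm
    · rw [h0, ← h']; exact (hs _ (by omega)).symm
    · rw [h0, ← h']; exact hs _ (by omega)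
    · rw [← h0]; exact hs 0 (by omega)
    · rw [← h0]; exact (hs 0 (by omega)).symm

theorem exists_splitHole {G : SimpleGraph V} {c d a b : V} {H : G.Walk d d}
    (hH : IsHoleWalk G H) (hc : c ∉ H.support) (had : a ≠ d) (hbd : b ≠ d)
    (hnbrs : HoleNbrs G H c = {a, b, d})
    (hab_e : s(a, b) ∈ H.edges) (had_e : s(a, d) ∉ H.edges) (hbd_e : s(b, d) ∉ H.edges) :
    ∃ (p q : ℕ → V) (m n : ℕ), SplitHole G c d p q m n ∧ a = p 0 ∧ b = q 0 ∧
      ∀ z, z ∈ H.support ↔ (∃ k ≤ m, z = p k) ∨ ∃ k ≤ n, z = q k := by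
  -- reduce to the orientation in which `H` visits `a` immediately before `b`
  suffices key : ∀ a b : V, a ≠ d → b ≠ d → HoleNbrs G H c = {a, b, d} →
      s(a, d) ∉ H.edges → s(b, d) ∉ H.edges →
      (∃ k < H.length, H.getVert k = a ∧ H.getVert (k + 1) = b) →
      ∃ (p q : ℕ → V) (m n : ℕ), SplitHole G c d p q m n ∧ a = p 0 ∧ b = q 0 ∧
        ∀ z, z ∈ H.support ↔ (∃ k ≤ m, z = p k) ∨ ∃ k ≤ n, z = q k by
    obtain ⟨k, hk, e⟩ := (H.mk_mem_edges_iff_exists).1 hab_e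
    rcases Sym2.eq_iff.1 e with ⟨h₁, h₂⟩ | ⟨h₁, h₂⟩
    · exact key a b had hbd hnbrs had_e hbd_e ⟨k, hk, h₁, h₂⟩
    · obtain ⟨p, q, m, n, F, hb, ha, hs⟩ := key b a hbd had
        (by rw [hnbrs, Set.insert_comm]) hbd_e had_e ⟨k, hk, h₁, h₂⟩
      exact ⟨q, p, n, m, F.symm, ha, hb, fun z => by rw [hs, or_comm]⟩
  clear had hbd hnbrs hab_e had_e hbd_e a b
  rintro a b had hbd hnbrs had_e hbd_e ⟨k, hk, rfl, rfl⟩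
  have hlen := hH.2.1
  have hinj := fun {i j} => getVert_eq_of_isCycle hH.1 (i := i) (j := j)
  have hadj := fun {i j} => adj_getVert_of_isHoleWalk hH (i := i) (j := j)
  have hmem := fun i => H.getVert_mem_support i
  have h0 : H.getVert 0 = d := by simp
  have hN : H.getVert H.length = d := by simp
  have hk0 : k ≠ 0 := by rintro rfl; exact had h0
  have hkN : k + 1 ≠ H.length := fun h => hbd (by rw [h, hN])
  have hk1 : k ≠ 1 := by
    rintro rfl
    exact had_e (hH.2.2 _ (hmem _) _ H.start_mem_support
      (by simpa [h0] using (hadj (i := 1) (j := 0) (by omega) (by omega)).2 (by omega)))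
  have hkN' : k + 2 ≠ H.length := fun h =>
    hbd_e (hH.2.2 _ (hmem _) _ H.start_mem_support
      (by simpa [hN] using (hadj (i := k + 1) (j := H.length) (by omega) le_rfl).2 (by omega)))
  have hcadj : ∀ {i}, i ≤ H.length →
      (G.Adj c (H.getVert i) ↔ i = k ∨ i = k + 1 ∨ i = 0 ∨ i = H.length) := by
    intro i hi
    have : G.Adj c (H.getVert i) ↔ H.getVert i ∈ HoleNbrs G H c :=
      ⟨fun h => ⟨hmem i, h⟩, fun h => h.2⟩
    rw [this, hnbrs]
    simp only [Set.mem_insert_iff, Set.mem_singleton_iff]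
    constructor
    · rintro (h | h | h)
      · have := hinj hi (by omega) h
        omega
      · have := hinj hi (by omega) h
        omega
      · have := hinj hi (Nat.zero_le _) (h.trans h0.symm)
        omega
    · rintro (rfl | rfl | rfl | rfl) <;> simp
  refine ⟨fun i => H.getVert (k - i), fun i => H.getVert (k + 1 + i), k, H.length - (k + 1),
    { two_le_left := by omega
      two_le_right := by omega
      left_end := by simp
      right_end := by rw [show k + 1 + (H.length - (k + 1)) = H.length by omega, hN]
      left_inj := fun hi hj e => by
        have := hinj (by omega) (by omega) e
        omega
      right_inj := fun hi hj e => by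
        have := hinj (by omega) (by omega) e
        omega
      left_adj := fun hi hj => (hadj (by omega) (by omega)).trans (by omega)
      right_adj := fun hi hj => (hadj (by omega) (by omega)).trans (by omega)
      cross_ne := fun hi hj e => by
        have := hinj (by omega) (by omega) e
        omega
      cross_adj := fun hi hj => (hadj (by omega) (by omega)).trans (by omega)
      center_ne_left := fun _ e => hc (e ▸ hmem _)
      center_ne_right := fun _ e => hc (e ▸ hmem _)
      center_adj_left := fun hi => (hcadj (by omega)).trans (by omega)
      center_adj_right := fun hi => (hcadj (by omega)).trans (by omega) },
    by simp, by simp, fun z => ⟨fun hz => ?_, ?_⟩⟩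
  · obtain ⟨i, rfl, hi⟩ := Walk.mem_support_iff_exists_getVert.1 hz
    rcases Nat.lt_or_ge k i with h | h
    · exact .inr ⟨i - (k + 1), by omega, by congr 1; omega⟩
    · exact .inl ⟨k - i, by omega, by congr 1; omega⟩
  · rintro (⟨i, -, rfl⟩ | ⟨i, -, rfl⟩) <;> exact hmem _

theorem exists_two_neighbors_of_mem_interior {G : SimpleGraph V} {x y w : V} {P : G.Walk x y}
    (hP : P.IsPath) (hw : w ∈ Interior P) :
    ∃ u ∈ P.support, ∃ v ∈ P.support, u ≠ v ∧ G.Adj w u ∧ G.Adj w v := by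
  obtain ⟨hw, hwx, hwy⟩ := hw
  obtain ⟨k, rfl, hk⟩ := Walk.mem_support_iff_exists_getVert.1 hw
  have hk0 : k ≠ 0 := by rintro rfl; exact hwx (by simp)
  have hkl : k ≠ P.length := by rintro rfl; exact hwy (by simp)
  refine ⟨_, P.getVert_mem_support (k - 1), _, P.getVert_mem_support (k + 1), fun e => ?_, ?_,
    P.adj_getVert_succ (by omega)⟩
  · have := hP.getVert_injOn (by simp; omega) (by simp; omega) e
    omega
  · have := P.adj_getVert_succ (i := k - 1) (by omega)
    rw [Nat.sub_add_cancel (by omega)] at this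
    exact this.symm

theorem SplitHole.path_subset_sector {G : SimpleGraph V} {c d : V} {p q : ℕ → V} {m n : ℕ}
    (F : SplitHole G c d p q m n) {h : V} {H : G.Walk h h}
    (hs : ∀ z ∈ H.support, (∃ k ≤ m, z = p k) ∨ ∃ k ≤ n, z = q k)
    {x y : V} {P : G.Walk x y} (hP : IsSector G H c P)
    {i : ℕ} (hi0 : 0 < i) (him : i < m) (hi : p i ∈ P.support) : ∀ k ≤ m, p k ∈ P.support := by
  obtain ⟨hpath, -, hsub, -, hcx, hcy, -⟩ := hP
  have step : ∀ k, 0 < k → k < m → p k ∈ P.support →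
      p (k - 1) ∈ P.support ∧ p (k + 1) ∈ P.support := by
    intro k hk0 hkm hk
    have hck : ¬ G.Adj c (p k) := fun h => by
      have := (F.center_adj_left hkm.le).1 h
      omega
    obtain ⟨u, hu, v, hv, huv, hku, hkv⟩ := exists_two_neighbors_of_mem_interior hpath
      ⟨hk, fun e => hck (e ▸ hcx), fun e => hck (e ▸ hcy)⟩
    have nb : ∀ z ∈ P.support, G.Adj (p k) z → z = p (k - 1) ∨ z = p (k + 1) := by
      intro z hz e
      have left : ∀ l ≤ m, G.Adj (p k) (p l) → p l = p (k - 1) ∨ p l = p (k + 1) := by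
        intro l hl e
        rcases (F.left_adj hkm.le hl).1 e with rfl | rfl
        exacts [.inr rfl, .inl rfl]
      rcases hs z (hsub z hz) with ⟨l, hl, rfl⟩ | ⟨l, hl, rfl⟩
      · exact left l hl e
      · rcases hl.lt_or_eq with hl' | rfl
        · have := (F.cross_adj hkm hl').1 e
          omega
        · rw [F.right_end, ← F.left_end] at e ⊢
          exact left m le_rfl e
    rcases nb u hu hku with rfl | rfl <;> rcases nb v hv hkv with rfl | rfl
    · exact (huv rfl).elim
    · exact ⟨hu, hv⟩
    · exact ⟨hv, hu⟩
    · exact (huv rfl).elim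
  have down : ∀ t, t ≤ i → p (i - t) ∈ P.support := by
    intro t
    induction t with
    | zero => exact fun _ => hi
    | succ t ih => exact fun ht => (step (i - t) (by omega) (by omega) (ih (by omega))).1
  have up : ∀ t, i + t ≤ m → p (i + t) ∈ P.support := by
    intro t
    induction t with
    | zero => exact fun _ => hi
    | succ t ih => exact fun ht => (step (i + t) (by omega) (by omega) (ih (by omega))).2
  intro k hk
  rcases le_total k i with h | h
  · simpa [Nat.sub_sub_self h] using down (i - k) (by omega)
  · simpa [Nat.add_sub_cancel' h] using up (k - i) (by omega)

theorem SplitHole.support_sector {G : SimpleGraph V} {c d : V} {p q : ℕ → V} {m n : ℕ}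
    (F : SplitHole G c d p q m n) {h : V} {H : G.Walk h h}
    (hs : ∀ z ∈ H.support, (∃ k ≤ m, z = p k) ∨ ∃ k ≤ n, z = q k)
    {x y : V} {P : G.Walk x y} (hP : IsSector G H c P)
    {i : ℕ} (hi0 : 0 < i) (him : i < m) (hi : p i ∈ P.support) :
    {w | w ∈ P.support} = {w | ∃ k ≤ m, w = p k} := by
  have hsub := F.path_subset_sector hs hP hi0 him hi
  refine Set.Subset.antisymm (fun w hw => ?_) (by rintro _ ⟨k, hk, rfl⟩; exact hsub k hk)
  by_contra hwp
  obtain ⟨-, -, hH, -, hcx, hcy, hmid⟩ := id hP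
  have ends : ∀ z ∈ P.support, G.Adj c z → z = x ∨ z = y := by
    intro z hz hcz
    by_contra! hne
    exact hmid z hz hne.1 hne.2 hcz
  have hm := F.two_le_left
  have hn := F.two_le_right
  have e₁ := ends _ (hsub 0 (Nat.zero_le m)) ((F.center_adj_left (Nat.zero_le m)).2 (.inl rfl))
  have e₂ := ends _ (hsub m le_rfl) ((F.center_adj_left le_rfl).2 (.inr rfl))
  have hne : p 0 ≠ p m := fun e => by
    have := F.left_inj (Nat.zero_le m) le_rfl e
    omega
  have noq : q 0 ∉ P.support := by
    intro hq
    have e₃ := ends _ hq ((F.center_adj_right (Nat.zero_le n)).2 (.inl rfl))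
    have h₁ : p 0 ≠ q 0 := F.cross_ne (by omega) (by omega)
    have h₂ : p m ≠ q 0 := fun e => by
      have := F.right_inj le_rfl (Nat.zero_le n) (F.right_end.trans (F.left_end.symm.trans e))
      omega
    grind
  rcases hs w (hH w hw) with hw' | ⟨k, hk, rfl⟩
  · exact hwp hw'
  · rcases Nat.eq_zero_or_pos k with rfl | hk0
    · exact noq hw
    rcases hk.lt_or_eq with hk' | rfl
    · exact noq (F.symm.path_subset_sector (fun z hz => (hs z hz).symm) hP hk0 hk' hw 0
        (Nat.zero_le n))
    · exact hwp ⟨m, le_rfl, F.right_end.trans F.left_end.symm⟩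

/-- breaking a special wheel whose long sectors have length at least three. -/
theorem statement_6 {V : Type} [Fintype V] (G : SimpleGraph V)
    (hth : ¬ ContainsTheta G) (hpr : ¬ ContainsPrism G)
    {h : V} (H : G.Walk h h) (c a b d : V)
    (hW : IsWheel G H c)
    (hab : a ≠ b) (had : a ≠ d) (hbd : b ≠ d)
    (hnbrs : HoleNbrs G H c = {a, b, d})
    (hab_e : s(a, b) ∈ H.edges) (had_e : s(a, d) ∉ H.edges) (hbd_e : s(b, d) ∉ H.edges)
    (hlong : ∀ {x y : V} (P : G.Walk x y), IsSector G H c P →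
      P.length = 1 ∨ 3 ≤ P.length)
    {x₁ x₂ y₁ y₂ : V} (P : G.Walk x₁ x₂) (Q : G.Walk y₁ y₂)
    (hP : IsSector G H c P) (hQ : IsSector G H c Q)
    (hPQ : {w | w ∈ P.support} ≠ {w | w ∈ Q.support})
    (a'' b'' : V)
    (ha : a'' ∈ Interior P) (hb : b'' ∈ Interior Q)
    (haZ : a'' ∉ ClosedNbhd G (ZSpecial G H c a b d))
    (hbZ : b'' ∉ ClosedNbhd G (ZSpecial G H c a b d)) :
    Separates G (ClosedNbhd G (ZSpecial G H c a b d)) a'' b'' := by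
  classical
  obtain ⟨⟨hcyc, hlen, hind⟩, hcH, -⟩ := hW
  have hd : d ∈ H.support := by
    have : d ∈ HoleNbrs G H c := by simp [hnbrs]
    exact this.1
  have hedge : ∀ e, e ∈ (H.rotate d hd).edges ↔ e ∈ H.edges := fun e =>
    (H.rotate_edges d hd).mem_iff
  have hsupp : ∀ z, z ∈ (H.rotate d hd).support ↔ z ∈ H.support := fun z =>
    H.mem_support_rotate_iff d hd
  obtain ⟨p, q, m, n, F, hap, hbq, hs⟩ := exists_splitHole (H := H.rotate d hd)
    ⟨(Walk.isCycle_rotate hd).2 hcyc, by simpa using hlen, fun x hx y hy h => by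
      rw [hedge]; exact hind x ((hsupp x).1 hx) y ((hsupp y).1 hy) h⟩
    (by rwa [hsupp]) had hbd (by rw [← hnbrs]; ext z; simp [HoleNbrs])
    (by rwa [hedge]) (by rwa [hedge]) (by rwa [hedge])
  simp only [hsupp] at hs
  set M := ClosedNbhd G (ZSpecial G H c a b d)
  have hZ : ∀ z ∉ M, ∀ w ∈ ZSpecial G H c a b d, z ≠ w ∧ ¬ G.Adj z w := fun z hz w hw =>
    ⟨fun e => hz (.inl (e ▸ hw)), fun e => hz (.inr ⟨w, hw, e⟩)⟩
  have hc : ∀ z ∉ M, z ≠ c ∧ ¬ G.Adj z c := fun z hz => hZ z hz c (by simp [ZSpecial])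
  have hend : ∀ {p q : ℕ → V} {m n : ℕ}, SplitHole G c d p q m n →
      p 0 ∈ ZSpecial G H c a b d → (∀ k ≤ m, p k ∈ H.support) → ∀ z ∉ M, ∀ k ≤ m,
      (z = p k → 0 < k ∧ k < m) ∧ (G.Adj z (p k) → 1 ≤ k ∧ k + 2 ≤ m) := by
    intro p q m n F h0 hH z hz k hk
    have hm := F.two_le_left
    have hpd := F.left_end
    have h₀ := hZ z hz (p 0) h0
    have h₁ := hZ z hz d (by simp [ZSpecial])
    have h₂ := hZ z hz (p (m - 1)) (.inr (hind _ (hH _ (by omega)) _ hd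
      (hpd ▸ (F.left_adj (by omega) le_rfl).2 (by omega))))
    rw [← hpd] at h₁
    refine ⟨fun e => ?_, fun e => ?_⟩
    · have : k ≠ 0 := by rintro rfl; exact h₀.1 e
      have : k ≠ m := by rintro rfl; exact h₁.1 e
      omega
    · have : k ≠ 0 := by rintro rfl; exact h₀.2 e
      have : k ≠ m := by rintro rfl; exact h₁.2 e
      have : k ≠ m - 1 := by rintro rfl; exact h₂.2 e
      omega
  have hp := hend F (by simp [ZSpecial, ← hap]) (fun k hk => (hs _).2 (.inl ⟨k, hk, rfl⟩))
  have hq := hend F.symm (by simp [ZSpecial, ← hbq]) (fun k hk => (hs _).2 (.inr ⟨k, hk, rfl⟩))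
  have hs' := fun z => (hs z).1
  have hs'' := fun z hz => ((hs z).1 hz).symm
  refine separates_of_not_reaches haZ hbZ ?_
  rcases (hs a'').1 (hP.2.2.1 _ ha.1) with ⟨i, hi, rfl⟩ | ⟨i, hi, rfl⟩ <;>
    rcases (hs b'').1 (hQ.2.2.1 _ hb.1) with ⟨j, hj, rfl⟩ | ⟨j, hj, rfl⟩
  · have hi' := (hp _ haZ i hi).1 rfl
    have hj' := (hp _ hbZ j hj).1 rfl
    exact (hPQ ((F.support_sector hs' hP hi'.1 hi'.2 ha.1).trans
      (F.support_sector hs' hQ hj'.1 hj'.2 hb.1).symm)).elim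
  · exact F.not_reaches_compl hth hpr hc hp hq hi hj
  · exact F.symm.not_reaches_compl hth hpr hc hq hp hi hj
  · have hi' := (hq _ haZ i hi).1 rfl
    have hj' := (hq _ hbZ j hj).1 rfl
    exact (hPQ ((F.symm.support_sector hs'' hP hi'.1 hi'.2 ha.1).trans
      (F.symm.support_sector hs'' hQ hj'.1 hj'.2 hb.1).symm)).elim

end Paper
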